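/- If 𝔭 < 𝔭_σ, then there exists a tower of cardinality 𝔭 (a family {T_α : α < 𝔭} ⊆ [ℕ]^ω with T_γ ⊆* T_β for β < γ and no pseudo-intersection); consequently, if 𝔭 < 𝔭_σ then 𝔭 = 𝔱. -/

import Mathlib

open Set Topology Filter

/-- The Pytkeev property of a topological space. -/
def PytkeevProp (Y : Type*) [TopologicalSpace Y] : Prop :=
  ∀ A : Set Y, ∀ y : Y, y ∈ closure A \ A →
    ∃ 𝒜 : ℕ → Set Y, (∀ n, (𝒜 n).Infinite ∧ 𝒜 n ⊆ A) ∧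
      ∀ U ∈ nhds y, ∃ n, 𝒜 n ⊆ U

/-- Countable tightness. -/
def CountableTightness (Y : Type*) [TopologicalSpace Y] : Prop :=
  ∀ A : Set Y, ∀ y ∈ closure A, ∃ B ⊆ A, B.Countable ∧ y ∈ closure B

/-- The Reznichenko property (weakly Fréchet-Urysohn). -/
def ReznichenkoProp (Y : Type*) [TopologicalSpace Y] : Prop :=
  ∀ A : Set Y, ∀ y : Y, y ∈ closure A \ A →
    ∃ F : ℕ → Set Y, (∀ n, F n ⊆ A ∧ (F n).Finite) ∧
      (∀ m n, m ≠ n → Disjoint (F m) (F n)) ∧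
      ∀ U ∈ nhds y, ∀ᶠ n in Filter.atTop, (F n ∩ U).Nonempty

/-- `C_p(X)`: continuous real-valued functions on `X`, as a subspace of `ℝ^X`
with the product (pointwise convergence) topology. -/
abbrev Cp (X : Type*) [TopologicalSpace X] : Type _ :=
  {f : X → ℝ // Continuous f}

/-- `C_p(X, S)`: continuous functions from `X` to `S ⊆ ℝ`, as a subspace of `ℝ^X`. -/
abbrev CpS (X : Type*) [TopologicalSpace X] (S : Set ℝ) : Type _ :=
  {f : X → ℝ // Continuous f ∧ ∀ x, f x ∈ S}

/-- `A` is a pseudo-intersection of `ℱ`: `A` is infinite and almost contained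
in every member of `ℱ`. -/
def IsPseudoIntersection (A : Set ℕ) (ℱ : Set (Set ℕ)) : Prop :=
  A.Infinite ∧ ∀ B ∈ ℱ, (A \ B).Finite

/-- A centered family in `[ℕ]^ω`: every nonempty finite subfamily has infinite
intersection (in particular all members are infinite). -/
def IsCentered (ℱ : Set (Set ℕ)) : Prop :=
  ∀ 𝒢 ⊆ ℱ, 𝒢.Finite → 𝒢.Nonempty → (⋂₀ 𝒢).Infinite

/-- The pseudo-intersection number 𝔭. -/
noncomputable def pNumber : Cardinal :=
  sInf { c : Cardinal | ∃ ℱ : Set (Set ℕ), IsCentered ℱ ∧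
    (¬ ∃ A, IsPseudoIntersection A ℱ) ∧ Cardinal.mk ℱ = c }

/-- The cardinal 𝔭_σ. -/
noncomputable def pSigmaNumber : Cardinal :=
  sInf { c : Cardinal | ∃ ℱ : Set (Set ℕ), IsCentered ℱ ∧
    (∀ 𝒬 : ℕ → Set (Set ℕ), (⋃ n, 𝒬 n) = ℱ →
      ∃ n, ¬ ∃ A, IsPseudoIntersection A (𝒬 n)) ∧ Cardinal.mk ℱ = c }

/-- A tower: a family in `[ℕ]^ω` linearly ordered by `⊆*` with no
pseudo-intersection. -/
def IsTower (ℱ : Set (Set ℕ)) : Prop :=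
  (∀ A ∈ ℱ, A.Infinite) ∧
  (∀ A ∈ ℱ, ∀ B ∈ ℱ, (A \ B).Finite ∨ (B \ A).Finite) ∧
  ¬ ∃ A, IsPseudoIntersection A ℱ

/-- The tower number 𝔱. -/
noncomputable def tNumber : Cardinal :=
  sInf { c : Cardinal | ∃ ℱ : Set (Set ℕ), IsTower ℱ ∧ Cardinal.mk ℱ = c }

/-- An ω-cover of `X`: `X` itself is not a member, and every finite subset of
`X` is contained in some member. -/
def IsOmegaCover {X : Type*} (𝒰 : Set (Set X)) : Prop :=
  Set.univ ∉ 𝒰 ∧ ∀ F : Set X, F.Finite → ∃ U ∈ 𝒰, F ⊆ U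

/-- `⟨ℱ⟩`: the closure of `ℱ` under intersections of (nonempty) finite subfamilies. -/
def FinInterClosure (ℱ : Set (Set ℕ)) : Set (Set ℕ) :=
  { S | ∃ 𝒢 ⊆ ℱ, 𝒢.Finite ∧ 𝒢.Nonempty ∧ S = ⋂₀ 𝒢 }

/-- A zero-dimensional space: the clopen sets form a base. -/
def ZeroDimensionalSpace (X : Type*) [TopologicalSpace X] : Prop :=
  ∀ x : X, ∀ U ∈ nhds x, ∃ V : Set X, IsClopen V ∧ x ∈ V ∧ V ⊆ U

/-- The set `S₀ = {1/n : n ∈ ℕ} ∪ {0} ⊆ ℝ`. -/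
def Szero : Set ℝ := {x : ℝ | ∃ n : ℕ, x = 1 / (n + 1)} ∪ {0}

/-- An ω-groupable family: it can be partitioned into finite pieces such that
every finite `F ⊆ X` is contained in some member of all but finitely many pieces. -/
def IsOmegaGroupable {X : Type*} (𝒰 : Set (Set X)) : Prop :=
  ∃ 𝒬 : Set (Set (Set X)), (∀ ℱ ∈ 𝒬, ℱ.Finite) ∧
    𝒬.PairwiseDisjoint id ∧ ⋃₀ 𝒬 = 𝒰 ∧
    ∀ F : Set X, F.Finite → { ℱ ∈ 𝒬 | ¬ ∃ U ∈ ℱ, F ⊆ U }.Finite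

/-- almost inclusion -/
def ASub (A B : Set ℕ) : Prop := (A \ B).Finite

theorem ASub.trans {A B C : Set ℕ} (h : ASub A B) (h' : ASub B C) : ASub A C := by
  refine (Set.Finite.union h h').subset ?_
  rintro x ⟨hA, hC⟩
  by_cases hB : x ∈ B
  · exact Or.inr ⟨hB, hC⟩
  · exact Or.inl ⟨hA, hB⟩

theorem ASub.of_subset {A B : Set ℕ} (h : A ⊆ B) : ASub A B := by
  unfold ASub
  rw [Set.sdiff_eq_empty.2 h]
  exact Set.finite_empty

theorem ASub.inter {A B C : Set ℕ} (h : ASub A B) (h' : ASub A C) : ASub A (B ∩ C) := by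
  unfold ASub
  rw [Set.sdiff_inter]
  exact Set.Finite.union h h'

theorem ASub.infinite {A B : Set ℕ} (h : ASub A B) (hA : A.Infinite) : B.Infinite := by
  intro hB
  apply hA
  refine (Set.Finite.union h hB).subset ?_
  intro x hx
  by_cases hxB : x ∈ B
  · exact Or.inr hxB
  · exact Or.inl ⟨hx, hxB⟩

theorem centered_of_directed (𝒢 : Set (Set ℕ)) (hinf : ∀ A ∈ 𝒢, A.Infinite)
    (hd : ∀ A ∈ 𝒢, ∀ B ∈ 𝒢, ∃ C ∈ 𝒢, ASub C A ∧ ASub C B) : IsCentered 𝒢 := by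
  intro H hH hfin hne
  have key : ∃ C ∈ 𝒢, ASub C (⋂₀ H) := by
    obtain ⟨A0, hA0⟩ := hne
    have h0 := hH hA0
    clear hA0
    induction H, hfin using Set.Finite.induction_on with
    | empty => exact ⟨A0, h0, ASub.of_subset (by simp)⟩
    | @insert a s ha hs ih =>
      obtain ⟨C, hC, hCs⟩ := ih (fun x hx => hH (Set.mem_insert_of_mem _ hx))
      obtain ⟨D, hD, h1, h2⟩ := hd C hC a (hH (Set.mem_insert _ _))
      refine ⟨D, hD, ?_⟩
      rw [Set.sInter_insert]
      exact h2.inter (h1.trans hCs)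
  obtain ⟨C, hC, h⟩ := key
  exact h.infinite (hinf C hC)

/-- every centered family of size `< pSigma` splits. -/
theorem sigma_split {𝒢 : Set (Set ℕ)} (hc : IsCentered 𝒢)
    (hcard : Cardinal.mk 𝒢 < pSigmaNumber) :
    ∃ A : ℕ → Set ℕ, (∀ n, (A n).Infinite) ∧ ∀ G ∈ 𝒢, ∃ n, ASub (A n) G := by
  by_contra hcon
  have : pSigmaNumber ≤ Cardinal.mk 𝒢 := by
    apply csInf_le'
    refine ⟨𝒢, hc, ?_, rfl⟩
    intro Q hQ
    by_contra hall
    push Not at hall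
    choose A hA using hall
    apply hcon
    refine ⟨A, fun n => (hA n).1, fun G hG => ?_⟩
    rw [← hQ] at hG
    obtain ⟨n, hn⟩ := Set.mem_iUnion.1 hG
    exact ⟨n, (hA n).2 G hn⟩
  exact absurd hcard (not_lt.2 this)

def BddFam (κ : Cardinal.{0}) : Prop :=
  ∀ H : Set (ℕ → ℕ), Cardinal.mk H ≤ κ → ∃ g : ℕ → ℕ, ∀ f ∈ H, ∃ N, ∀ n ≥ N, f n ≤ g n

theorem extension {κ : Cardinal.{0}} (hκ : Cardinal.aleph0 ≤ κ) (hσ : κ < pSigmaNumber)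
    (hB : BddFam κ) (ℱ 𝒯 : Set (Set ℕ)) (hF : ∀ F ∈ ℱ, F.Infinite)
    (hFi : ∀ F ∈ ℱ, ∀ G ∈ ℱ, F ∩ G ∈ ℱ) (hFc : Cardinal.mk ℱ ≤ κ) (hTc : Cardinal.mk 𝒯 ≤ κ)
    (hch : ∀ A ∈ 𝒯, ∀ B ∈ 𝒯, ASub A B ∨ ASub B A)
    (hTF : ∀ A ∈ 𝒯, ∀ F ∈ ℱ, (A ∩ F).Infinite) :
    ∃ T : Set ℕ, (∀ A ∈ 𝒯, ASub T A) ∧ ∀ F ∈ ℱ, (T ∩ F).Infinite := by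
  rcases 𝒯.eq_empty_or_nonempty with rfl | hne
  · exact ⟨Set.univ, by simp, by simpa using hF⟩
  by_cases hcof : ∃ S ⊆ 𝒯, S.Countable ∧ ∀ A ∈ 𝒯, ∃ B ∈ S, ASub B A
  · obtain ⟨S, hS, hSc, hScof⟩ := hcof
    have hSne : S.Nonempty := by
      obtain ⟨A, hA⟩ := hne
      obtain ⟨B, hB, _⟩ := hScof A hA
      exact ⟨B, hB⟩
    obtain ⟨s, rfl⟩ := hSc.exists_eq_range hSne
    have hs : ∀ k, s k ∈ 𝒯 := fun k => hS ⟨k, rfl⟩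
    let C : ℕ → Set ℕ := fun k => {x | ∀ j ≤ k, x ∈ s j}
    have hC : ∀ k, ∃ j, ASub (s j) (C k) := by
      intro k
      induction k with
      | zero => exact ⟨0, ASub.of_subset (fun x hx j hj => by
          obtain rfl : j = 0 := by omega
          exact hx)⟩
      | succ k ih =>
        obtain ⟨j, hj⟩ := ih
        have hsub : C k ∩ s (k+1) ⊆ C (k+1) := by
          rintro x ⟨h1, h2⟩ i hi
          rcases Nat.lt_or_ge i (k+1) with h | h
          · exact h1 i (by omega)
          · obtain rfl : i = k+1 := by omega
            exact h2
        rcases hch (s j) (hs j) (s (k+1)) (hs _) with h | h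
        · exact ⟨j, (hj.inter h).trans (ASub.of_subset hsub)⟩
        · exact ⟨k+1, ((h.trans hj).inter (ASub.of_subset subset_rfl)).trans
            (ASub.of_subset hsub)⟩
    have hCF : ∀ F ∈ ℱ, ∀ k, ∃ x, x ∈ C k ∩ F ∧ k < x := by
      intro F hFm k
      obtain ⟨j, hj⟩ := hC k
      have : (C k ∩ F).Infinite := by
        refine ASub.infinite (A := s j ∩ F) ?_ (hTF _ (hs j) F hFm)
        exact ((ASub.of_subset Set.inter_subset_left).trans hj).inter
          (ASub.of_subset Set.inter_subset_right)
      obtain ⟨x, hx, hkx⟩ := this.exists_gt k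
      exact ⟨x, hx, hkx⟩
    choose! f hf hfk using hCF
    obtain ⟨g, hg⟩ := hB (f '' ℱ) (Cardinal.mk_image_le.trans hFc)
    refine ⟨{x | ∃ k, x ∈ C k ∧ x ≤ g k}, ?_, ?_⟩
    · intro A hA
      obtain ⟨_, ⟨j, rfl⟩, hj⟩ := hScof A hA
      refine ASub.trans ?_ hj
      refine (Set.Finite.biUnion (Set.finite_lt_nat j) (fun k _ => Set.finite_le_nat (g k))).subset ?_
      rintro x ⟨⟨k, hk, hxg⟩, hx⟩
      simp only [Set.mem_iUnion, Set.mem_ofPred_eq]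
      refine ⟨k, ?_, hxg⟩
      by_contra hlt
      exact hx (hk j (by omega))
    · intro F hFm
      obtain ⟨N, hN⟩ := hg (f F) ⟨F, hFm, rfl⟩
      apply Set.infinite_of_forall_exists_gt
      intro a
      refine ⟨f F (max a N), ⟨⟨max a N, (hf F hFm _).1, hN _ (le_max_right _ _)⟩,
        (hf F hFm _).2⟩, lt_of_le_of_lt (le_max_left _ _) (hfk F hFm _)⟩
  · let 𝒢 : Set (Set ℕ) := Set.image2 (fun A F => A ∩ F) 𝒯 ℱ
    have hGc : Cardinal.mk 𝒢 ≤ κ := by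
      have h1 : 𝒢 = (fun p : Set ℕ × Set ℕ => p.1 ∩ p.2) '' (𝒯 ×ˢ ℱ) := by
        rw [Set.image_prod]
      rw [h1]
      refine Cardinal.mk_image_le.trans ?_
      rw [Cardinal.mk_setProd]
      exact (mul_le_mul' hTc hFc).trans (Cardinal.mul_eq_self hκ).le
    have hGcen : IsCentered 𝒢 := by
      apply centered_of_directed
      · rintro _ ⟨A, hA, F, hFm, rfl⟩
        exact hTF A hA F hFm
      · rintro _ ⟨A, hA, F, hFm, rfl⟩ _ ⟨B, hBm, G, hGm, rfl⟩
        have l : ∀ X Y : Set ℕ, ASub (X ∩ Y) X := fun X Y => ASub.of_subset Set.inter_subset_left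
        have r : ∀ X Y : Set ℕ, ASub (X ∩ Y) Y := fun X Y => ASub.of_subset Set.inter_subset_right
        rcases hch A hA B hBm with h | h
        · exact ⟨A ∩ (F ∩ G), ⟨A, hA, _, hFi F hFm G hGm, rfl⟩,
            (l _ _).inter ((r _ _).trans (l _ _)), ((l _ _).trans h).inter ((r _ _).trans (r _ _))⟩
        · exact ⟨B ∩ (F ∩ G), ⟨B, hBm, _, hFi F hFm G hGm, rfl⟩,
            ((l _ _).trans h).inter ((r _ _).trans (l _ _)), (l _ _).inter ((r _ _).trans (r _ _))⟩
    obtain ⟨A, hAinf, hA⟩ := sigma_split hGcen (hGc.trans_lt hσ)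
    have key : ∀ F ∈ ℱ, ∃ n, ASub (A n) F ∧ ∀ B ∈ 𝒯, ASub (A n) B := by
      intro F hFm
      by_contra hcon
      push Not at hcon
      apply hcof
      -- for each n a bad element
      have hb : ∀ n, ∃ B ∈ 𝒯, ASub (A n) F → ¬ ASub (A n) B := by
        intro n
        by_cases h : ASub (A n) F
        · obtain ⟨B, hB1, hB2⟩ := hcon n h
          exact ⟨B, hB1, fun _ => hB2⟩
        · obtain ⟨B, hB⟩ := hne
          exact ⟨B, hB, fun h' => absurd h' h⟩
      choose b hbT hb using hb
      refine ⟨Set.range b, by rintro _ ⟨n, rfl⟩; exact hbT n, Set.countable_range b, ?_⟩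
      intro D hD
      obtain ⟨n, hn⟩ := hA (D ∩ F) ⟨D, hD, F, hFm, rfl⟩
      have hnF : ASub (A n) F := hn.trans (ASub.of_subset Set.inter_subset_right)
      have hnD : ASub (A n) D := hn.trans (ASub.of_subset Set.inter_subset_left)
      refine ⟨b n, ⟨n, rfl⟩, ?_⟩
      rcases hch (b n) (hbT n) D hD with h | h
      · exact h
      · exact absurd (hnD.trans h) (hb n hnF)
    let I : Set ℕ := {n | ∀ B ∈ 𝒯, ASub (A n) B}
    have hf : ∀ B ∈ 𝒯, ∀ n, ∃ m, n ∈ I → ∀ x ∈ A n \ B, x < m := by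
      intro B hBm n
      by_cases h : n ∈ I
      · obtain ⟨m, hm⟩ := (h B hBm).bddAbove
        exact ⟨m+1, fun _ x hx => Nat.lt_succ_of_le (hm hx)⟩
      · exact ⟨0, fun h' => absurd h' h⟩
    choose! f hf using hf
    obtain ⟨g, hg⟩ := hB (f '' 𝒯) (Cardinal.mk_image_le.trans hTc)
    refine ⟨{x | ∃ n ∈ I, x ∈ A n ∧ g n ≤ x}, ?_, ?_⟩
    · intro B hBm
      obtain ⟨N, hN⟩ := hg (f B) ⟨B, hBm, rfl⟩
      refine (Set.Finite.biUnion (Set.finite_lt_nat N)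
        (fun k _ => Set.finite_lt_nat (f B k))).subset ?_
      rintro x ⟨⟨n, hn, hx, hgx⟩, hxB⟩
      have hlt := hf B hBm n hn x ⟨hx, hxB⟩
      simp only [Set.mem_iUnion, Set.mem_ofPred_eq]
      refine ⟨n, ?_, hlt⟩
      by_contra hlt'
      have := hN n (by omega)
      omega
    · intro F hFm
      obtain ⟨n, hn, hnI⟩ := key F hFm
      refine ASub.infinite (A := A n) (ASub.inter ?_ hn) (hAinf n)
      refine (Set.finite_lt_nat (g n)).subset ?_
      rintro x ⟨hx, hx'⟩
      by_contra hlt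
      exact hx' ⟨n, hnI, hx, not_lt.1 hlt⟩

/-- transfinite recursion -/
theorem tower_rec (κ : Ordinal.{0}) (P : Set ℕ → Prop) (R : Ordinal.{0} → Set ℕ → Prop)
    (hstep : ∀ α < κ, ∀ T : Ordinal.{0} → Set ℕ, (∀ β < α, P (T β)) →
      (∀ β γ, β < γ → γ < α → ASub (T γ) (T β)) →
      ∃ X, P X ∧ R α X ∧ ∀ β < α, ASub X (T β)) :
    ∃ T : Ordinal.{0} → Set ℕ, (∀ α < κ, P (T α) ∧ R α (T α)) ∧
      ∀ β γ, β < γ → γ < κ → ASub (T γ) (T β) := by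
  classical
  let good : (α : Ordinal.{0}) → ((β : Ordinal.{0}) → β < α → Set ℕ) → Set ℕ → Prop :=
    fun α T X => P X ∧ R α X ∧ ∀ β (h : β < α), ASub X (T β h)
  let T : Ordinal.{0} → Set ℕ := WellFounded.fix (C := fun _ => Set ℕ) Ordinal.lt_wf
    (fun α T => if h : ∃ X, good α T X then h.choose else ∅)
  have hT : ∀ α, (∃ X, good α (fun β _ => T β) X) → good α (fun β _ => T β) (T α) := by
    intro α h
    have : T α = h.choose := by
      show WellFounded.fix _ _ _ = _
      rw [WellFounded.fix_eq]
      exact dif_pos h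
    rw [this]
    exact h.choose_spec
  have main : ∀ α < κ, good α (fun β _ => T β) (T α) := by
    intro α
    induction α using WellFoundedLT.induction with
    | ind α ih =>
      intro hα
      apply hT
      exact hstep α hα T (fun β hβ => (ih β hβ (hβ.trans hα)).1)
        (fun β γ hβ hγ => (ih γ hγ (hγ.trans hα)).2.2 β hβ)
  exact ⟨T, fun α hα => ⟨(main α hα).1, (main α hα).2.1⟩,
    fun β γ hβ hγ => (main γ hγ).2.2 β hβ⟩

theorem mk_image_Iio_le (T : Ordinal.{0} → Set ℕ) (α : Ordinal.{0}) :
    Cardinal.mk (T '' Set.Iio α) ≤ α.card := by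
  have h := Cardinal.mk_image_le_lift (f := T) (s := Set.Iio α)
  rw [Cardinal.mk_Iio_ordinal] at h
  rw [Cardinal.lift_le.{1}.symm]
  simpa using h

theorem exists_enum {β : Type} (S : Set β) (hS : S.Nonempty) :
    ∃ f : Ordinal.{0} → β, (∀ o, f o ∈ S) ∧ ∀ F ∈ S, ∃ o < (Cardinal.mk S).ord, f o = F := by
  classical
  have h : Cardinal.lift.{1} (Cardinal.mk S) =
      Cardinal.lift.{0} (Cardinal.mk (Set.Iio (Cardinal.mk S).ord)) := by
    rw [Cardinal.mk_Iio_ordinal]; simp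
  obtain ⟨e⟩ := Cardinal.lift_mk_eq'.1 h
  obtain ⟨x0, hx0⟩ := hS
  refine ⟨fun o => if ho : o < (Cardinal.mk S).ord then (e.symm ⟨o, ho⟩ : β) else x0, ?_, ?_⟩
  · intro o
    dsimp only
    split_ifs
    · exact Subtype.coe_prop _
    · exact hx0
  · intro F hFm
    refine ⟨e ⟨F, hFm⟩, (e ⟨F, hFm⟩).2, ?_⟩
    dsimp only
    rw [dif_pos (Set.mem_Iio.1 (e ⟨F, hFm⟩).2)]
    exact congrArg Subtype.val (e.symm_apply_apply ⟨F, hFm⟩)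

theorem pseudo_of_lt {𝒢 : Set (Set ℕ)} (hc : IsCentered 𝒢) (h : Cardinal.mk 𝒢 < pNumber) :
    ∃ A, IsPseudoIntersection A 𝒢 := by
  by_contra hcon
  exact absurd h (not_lt.2 (csInf_le' ⟨𝒢, hc, hcon, rfl⟩))

def Sparse (f : ℕ → ℕ) (T : Set ℕ) : Prop :=
  ∃ k, ∀ m ∈ T, ∀ m' ∈ T, k ≤ m → m < m' → f m < m'

theorem exists_sparse (f : ℕ → ℕ) (hf : Monotone f) {T : Set ℕ} (hT : T.Infinite) :
    ∃ X ⊆ T, X.Infinite ∧ Sparse f X := by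
  have h : ∀ n, ∃ m ∈ T, n < m := fun n => hT.exists_gt n
  choose nx hnT hn using h
  let a : ℕ → ℕ := fun i => Nat.rec (nx 0) (fun _ x => nx (max x (f x))) i
  have ha : ∀ i, a (i+1) = nx (max (a i) (f (a i))) := fun i => rfl
  have hlt : ∀ i, a i < a (i+1) := fun i => by
    rw [ha]; exact lt_of_le_of_lt (le_max_left _ _) (hn _)
  have hlt' : ∀ i, f (a i) < a (i+1) := fun i => by
    rw [ha]; exact lt_of_le_of_lt (le_max_right _ _) (hn _)
  have hmono : StrictMono a := strictMono_nat_of_lt_succ hlt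
  refine ⟨Set.range a, ?_, Set.infinite_range_of_injective hmono.injective, 0, ?_⟩
  · rintro _ ⟨i, rfl⟩
    cases i with
    | zero => exact hnT _
    | succ i => rw [ha]; exact hnT _
  · rintro _ ⟨i, rfl⟩ _ ⟨j, rfl⟩ _ hij
    have : i < j := hmono.lt_iff_lt.1 hij
    exact (hlt' i).trans_le (hmono.monotone this)

theorem Sparse.of_asub {f : ℕ → ℕ} {A T : Set ℕ} (h : Sparse f T) (hA : ASub A T) :
    Sparse f A := by
  obtain ⟨k, hk⟩ := h
  obtain ⟨m, hm⟩ := Set.Finite.bddAbove hA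
  have hmem : ∀ x ∈ A, m + 1 ≤ x → x ∈ T := by
    intro x hx hxm
    by_contra hxT
    have := hm ⟨hx, hxT⟩
    omega
  exact ⟨k + m + 1, fun x hx y hy h1 h2 =>
    hk x (hmem x hx (by omega)) y (hmem y hy (by omega)) (by omega) h2⟩

theorem tower_of_not_bdd (hB : ¬ BddFam pNumber) :
    ∃ T : Ordinal.{0} → Set ℕ,
      (∀ α < pNumber.ord, (T α).Infinite) ∧
      (∀ β γ, β < γ → γ < pNumber.ord → ASub (T γ) (T β)) ∧
      ¬ ∃ A : Set ℕ, A.Infinite ∧ ∀ α < pNumber.ord, ASub A (T α) := by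
  unfold BddFam at hB
  push Not at hB
  obtain ⟨H, hH, hunb⟩ := hB
  have hHne : H.Nonempty := by
    obtain ⟨f, hf, _⟩ := hunb id
    exact ⟨f, hf⟩
  obtain ⟨e, heH, he⟩ := exists_enum H hHne
  let mx : (ℕ → ℕ) → ℕ → ℕ := fun f => partialSups f
  have hmx : ∀ f, Monotone (mx f) := fun f => (partialSups f).monotone
  have hle : ∀ f n, f n ≤ mx f n := fun f n => le_partialSups f n
  obtain ⟨T, hT, hdec⟩ := tower_rec pNumber.ord (fun X => X.Infinite)
    (fun α X => Sparse (mx (e α)) X) (by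
      intro α hα T hinf hdec
      have hc : IsCentered (T '' Set.Iio α) := by
        apply centered_of_directed
        · rintro _ ⟨β, hβ, rfl⟩
          exact hinf β hβ
        · rintro _ ⟨β, hβ, rfl⟩ _ ⟨γ, hγ, rfl⟩
          rcases lt_trichotomy β γ with h | rfl | h
          · exact ⟨T γ, ⟨γ, hγ, rfl⟩, hdec β γ h hγ, ASub.of_subset subset_rfl⟩
          · exact ⟨T β, ⟨β, hβ, rfl⟩, ASub.of_subset subset_rfl, ASub.of_subset subset_rfl⟩
          · exact ⟨T β, ⟨β, hβ, rfl⟩, ASub.of_subset subset_rfl, hdec γ β h hβ⟩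
      obtain ⟨A, hAi, hA⟩ := pseudo_of_lt hc
        ((mk_image_Iio_le T α).trans_lt (Cardinal.lt_ord.1 hα))
      obtain ⟨X, hXA, hXi, hXs⟩ := exists_sparse (mx (e α)) (hmx _) hAi
      exact ⟨X, hXi, hXs, fun β hβ => (ASub.of_subset hXA).trans (hA _ ⟨β, hβ, rfl⟩)⟩)
  refine ⟨T, fun α hα => (hT α hα).1, hdec, ?_⟩
  rintro ⟨A, hAi, hA⟩
  have h : ∀ n, ∃ m ∈ A, n < m := fun n => hAi.exists_gt n
  choose nx hnA hn using h
  obtain ⟨f, hf, hfb⟩ := hunb (fun n => nx (nx n))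
  obtain ⟨o, ho, rfl⟩ := he f hf
  have ho' : o < pNumber.ord := ho.trans_le (Cardinal.ord_le_ord.2 hH)
  obtain ⟨k, hk⟩ := (hT o ho').2.of_asub (hA o ho')
  obtain ⟨n, hn1, hn2⟩ := hfb k
  have h1 := hk (nx n) (hnA _) (nx (nx n)) (hnA _) (by have := hn n; omega) (hn _)
  have h2 := hle (e o) n
  have h3 := hmx (e o) (hn n).le
  omega

theorem tower_of_bdd (hσ : pNumber < pSigmaNumber) (hB : BddFam pNumber) :
    ∃ T : Ordinal.{0} → Set ℕ,
      (∀ α < pNumber.ord, (T α).Infinite) ∧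
      (∀ β γ, β < γ → γ < pNumber.ord → ASub (T γ) (T β)) ∧
      ¬ ∃ A : Set ℕ, A.Infinite ∧ ∀ α < pNumber.ord, ASub A (T α) := by
  have hne : { c : Cardinal | ∃ ℱ : Set (Set ℕ), IsCentered ℱ ∧
    (¬ ∃ A, IsPseudoIntersection A ℱ) ∧ Cardinal.mk ℱ = c }.Nonempty := by
    have : { c : Cardinal | ∃ ℱ : Set (Set ℕ), IsCentered ℱ ∧
      (∀ 𝒬 : ℕ → Set (Set ℕ), (⋃ n, 𝒬 n) = ℱ →
      ∃ n, ¬ ∃ A, IsPseudoIntersection A (𝒬 n)) ∧ Cardinal.mk ℱ = c }.Nonempty := by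
      by_contra hcon
      rw [Set.not_nonempty_iff_eq_empty] at hcon
      unfold pSigmaNumber at hσ
      rw [hcon, Cardinal.sInf_empty] at hσ
      exact absurd hσ (by simp)
    obtain ⟨c, ℱ, h1, h2, h3⟩ := this
    obtain ⟨_, hn⟩ := h2 (fun _ => ℱ) (Set.iUnion_const ℱ)
    exact ⟨c, ℱ, h1, hn, h3⟩
  obtain ⟨ℱ₀, hcen, hnp, hcard⟩ : pNumber ∈ _ := csInf_mem hne
  have hF0ne : ℱ₀.Nonempty := by
    by_contra hcon
    rw [Set.not_nonempty_iff_eq_empty] at hcon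
    subst hcon
    exact hnp ⟨Set.univ, Set.infinite_univ, by simp⟩
  have hF0inf : ℱ₀.Infinite := by
    intro hfin
    exact hnp ⟨⋂₀ ℱ₀, hcen ℱ₀ subset_rfl hfin hF0ne,
      fun B hB => ASub.of_subset (Set.sInter_subset_of_mem hB)⟩
  have hκ : Cardinal.aleph0 ≤ pNumber := by
    rw [← hcard]
    exact Cardinal.infinite_iff.1 hF0inf.to_subtype
  have hFc : Cardinal.mk (FinInterClosure ℱ₀) ≤ pNumber := by
    have hi : Infinite ℱ₀ := hF0inf.to_subtype
    rw [← hcard, ← Cardinal.mk_finset_of_infinite ℱ₀]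
    have hsub : FinInterClosure ℱ₀ ⊆
        Set.range (fun s : Finset ℱ₀ => ⋂₀ (Subtype.val '' (s : Set ℱ₀))) := by
      rintro _ ⟨G, hG, hfin, _, rfl⟩
      have hf : (Subtype.val ⁻¹' G : Set ℱ₀).Finite :=
        hfin.preimage Subtype.val_injective.injOn
      refine ⟨hf.toFinset, ?_⟩
      simp only [Set.Finite.coe_toFinset, Subtype.image_preimage_coe]
      rw [Set.inter_eq_right.2 hG]
    exact (Cardinal.mk_le_mk_of_subset hsub).trans Cardinal.mk_range_le
  have hFi : ∀ F ∈ FinInterClosure ℱ₀, ∀ G ∈ FinInterClosure ℱ₀, F ∩ G ∈ FinInterClosure ℱ₀ := by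
    rintro _ ⟨G, hG, hf, hn, rfl⟩ _ ⟨G', hG', hf', hn', rfl⟩
    exact ⟨G ∪ G', Set.union_subset hG hG', hf.union hf', hn.inl, Set.sInter_union _ _ |>.symm⟩
  have hFinf : ∀ F ∈ FinInterClosure ℱ₀, F.Infinite := by
    rintro _ ⟨G, hG, hf, hn, rfl⟩
    exact hcen G hG hf hn
  have hsub : ∀ F ∈ ℱ₀, F ∈ FinInterClosure ℱ₀ := fun F hF =>
    ⟨{F}, by simpa using hF, Set.finite_singleton F, Set.singleton_nonempty F, by simp⟩
  obtain ⟨e, heF, he⟩ := exists_enum ℱ₀ hF0ne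
  rw [hcard] at he
  obtain ⟨T, hT, hdec⟩ := tower_rec pNumber.ord
    (fun X => ∀ F ∈ FinInterClosure ℱ₀, (X ∩ F).Infinite)
    (fun α X => X ⊆ e α) (by
      intro α hα T hinf hdec
      obtain ⟨X, hX1, hX2⟩ := extension hκ hσ hB (FinInterClosure ℱ₀) (T '' Set.Iio α) hFinf hFi hFc
        ((mk_image_Iio_le T α).trans (Cardinal.lt_ord.1 hα).le) (by
          rintro _ ⟨β, hβ, rfl⟩ _ ⟨γ, hγ, rfl⟩
          rcases lt_trichotomy β γ with h | rfl | h
          · exact Or.inr (hdec β γ h hγ)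
          · exact Or.inl (ASub.of_subset subset_rfl)
          · exact Or.inl (hdec γ β h hβ)) (by
          rintro _ ⟨β, hβ, rfl⟩ F hF
          exact hinf β hβ F hF)
      refine ⟨X ∩ e α, ?_, Set.inter_subset_right, fun β hβ =>
        (ASub.of_subset Set.inter_subset_left).trans (hX1 _ ⟨β, hβ, rfl⟩)⟩
      intro F hF
      rw [Set.inter_assoc]
      exact hX2 _ (hFi _ (hsub _ (heF α)) F hF))
  refine ⟨T, ?_, hdec, ?_⟩
  · intro α hα
    exact ((hT α hα).1 _ (hsub _ (heF α))).mono Set.inter_subset_left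
  · rintro ⟨A, hAi, hA⟩
    refine hnp ⟨A, hAi, fun B hB => ?_⟩
    obtain ⟨o, ho, rfl⟩ := he B hB
    exact (hA o ho).trans (ASub.of_subset (hT o ho).2)

/-- if 𝔭 < 𝔭_σ then there is a tower `{T_α : α < 𝔭}` of
cardinality 𝔭, and consequently 𝔭 = 𝔱. -/
theorem statement6 (h : pNumber < pSigmaNumber) :
    (∃ T : Ordinal → Set ℕ,
      (∀ α < pNumber.ord, (T α).Infinite) ∧
      (∀ β γ, β < γ → γ < pNumber.ord → (T γ \ T β).Finite) ∧
      ¬ ∃ A : Set ℕ, A.Infinite ∧ ∀ α < pNumber.ord, (A \ T α).Finite) ∧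
    pNumber = tNumber := by
  have key : ∃ T : Ordinal.{0} → Set ℕ,
      (∀ α < pNumber.ord, (T α).Infinite) ∧
      (∀ β γ, β < γ → γ < pNumber.ord → (T γ \ T β).Finite) ∧
      ¬ ∃ A : Set ℕ, A.Infinite ∧ ∀ α < pNumber.ord, (A \ T α).Finite := by
    by_cases hB : BddFam pNumber
    · exact tower_of_bdd h hB
    · exact tower_of_not_bdd hB
  refine ⟨key, ?_⟩
  obtain ⟨T, hTi, hTd, hTn⟩ := key
  have htow : IsTower (T '' Set.Iio pNumber.ord) := by
    refine ⟨?_, ?_, ?_⟩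
    · rintro _ ⟨β, hβ, rfl⟩
      exact hTi β hβ
    · rintro _ ⟨β, hβ, rfl⟩ _ ⟨γ, hγ, rfl⟩
      rcases lt_trichotomy β γ with h | rfl | h
      · exact Or.inr (hTd β γ h hγ)
      · exact Or.inl (ASub.of_subset subset_rfl)
      · exact Or.inl (hTd γ β h hβ)
    · rintro ⟨A, hA, hA'⟩
      exact hTn ⟨A, hA, fun α hα => hA' _ ⟨α, hα, rfl⟩⟩
  apply le_antisymm
  · refine le_csInf ⟨_, _, htow, rfl⟩ ?_
    rintro c ⟨ℱ, ⟨h1, h2, h3⟩, rfl⟩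
    refine csInf_le' ⟨ℱ, ?_, h3, rfl⟩
    refine centered_of_directed ℱ h1 ?_
    intro A hA B hB
    rcases h2 A hA B hB with h | h
    · exact ⟨A, hA, ASub.of_subset subset_rfl, h⟩
    · exact ⟨B, hB, h, ASub.of_subset subset_rfl⟩
  · refine (csInf_le' ⟨_, htow, rfl⟩ : tNumber ≤ _).trans ?_
    refine (mk_image_Iio_le T _).trans ?_
    simp
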